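/- Let k be an infinite field, R = k[x₀,…,x₅] graded by total degree, f ∈ R an irreducible homogeneous polynomial of degree 3, S = R/(f) with the induced grading, and r ≥ 1 an integer. Let M be a finitely generated graded S-module such that: (i) dim_k M_d = 3r·C(d+4, 4) for every integer d ≥ 0 (where C(n, m) is the binomial coefficient) and M_d = 0 for every d < 0; and (ii) there exist 5 linear forms in R whose images in S form an M-regular sequence. Then there is an exact sequence of graded R-modules 0 → R(−1)^{3r} → R^{3r} → M → 0 in which the first map is given by a 3r×3r matrix all of whose entries are homogeneous of degree 1. -/

import Mathlib

set_option synthInstance.maxHeartbeats 1000000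
set_option maxHeartbeats 1000000

section GradedRegularSequence

variable {k M : Type*} [Field k] [AddCommGroup M] [Module k M]

/-- The sum of the images of the first `i` operators. -/
def imageSum (T : ℕ → M →ₗ[k] M) : ℕ → Submodule k M
  | 0 => ⊥
  | i + 1 => imageSum T i ⊔ LinearMap.range (T i)

/-- The degree `d` part of the sum of the images of the first `i` operators, each of degree one. -/
def gradedImageSum (T : ℕ → M →ₗ[k] M) (ℳ : ℤ → Submodule k M) : ℕ → ℤ → Submodule k M
  | 0, _ => ⊥
  | i + 1, d => gradedImageSum T ℳ i d ⊔ (ℳ (d - 1)).map (T i)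

variable {T : ℕ → M →ₗ[k] M} {ℳ : ℤ → Submodule k M}

theorem gradedImageSum_le_imageSum (i : ℕ) (d : ℤ) :
    gradedImageSum T ℳ i d ≤ imageSum T i := by
  induction i with
  | zero => exact le_rfl
  | succ i ih => exact sup_le_sup ih (LinearMap.map_le_range)

theorem gradedImageSum_le (hT : ∀ i d, ∀ m ∈ ℳ d, T i m ∈ ℳ (d + 1)) (i : ℕ) (d : ℤ) :
    gradedImageSum T ℳ i d ≤ ℳ d := by
  induction i with
  | zero => exact bot_le
  | succ i ih =>
    refine sup_le ih ?_
    rintro _ ⟨m, hm, rfl⟩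
    simpa using hT i _ m hm

theorem map_gradedImageSum_le (hT : ∀ i d, ∀ m ∈ ℳ d, T i m ∈ ℳ (d + 1))
    (hcomm : ∀ i j m, T i (T j m) = T j (T i m)) (i j : ℕ) (d : ℤ) :
    (gradedImageSum T ℳ i d).map (T j) ≤ gradedImageSum T ℳ i (d + 1) := by
  induction i with
  | zero => simp [gradedImageSum]
  | succ i ih =>
    rw [gradedImageSum, Submodule.map_sup]
    refine sup_le_sup ih ?_
    rintro _ ⟨_, ⟨m, hm, rfl⟩, rfl⟩
    refine ⟨T j m, ?_, hcomm i j m⟩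
    have := hT j _ m hm
    rw [sub_add_cancel] at this
    rwa [add_sub_cancel_right]

theorem decompose_map_apply [DirectSum.Decomposition ℳ] {f : M →ₗ[k] M}
    (hf : ∀ d, ∀ m ∈ ℳ d, f m ∈ ℳ (d + 1)) (d : ℤ) (m : M) :
    (DirectSum.decompose ℳ (f m) (d + 1) : M) = f (DirectSum.decompose ℳ m d) := by
  induction m using DirectSum.Decomposition.inductionOn ℳ with
  | zero => simp
  | @homogeneous e m =>
    by_cases h : e = d
    · subst h
      rw [DirectSum.decompose_of_mem_same ℳ (hf _ _ m.2), DirectSum.decompose_of_mem_same ℳ m.2]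
    · rw [DirectSum.decompose_of_mem_ne ℳ (hf _ _ m.2) (by simpa using h),
        DirectSum.decompose_of_mem_ne ℳ m.2 h, map_zero]
  | add m m' h h' => simp [DirectSum.decompose_add, h, h']

theorem decompose_mem_gradedImageSum [DirectSum.Decomposition ℳ]
    (hT : ∀ i d, ∀ m ∈ ℳ d, T i m ∈ ℳ (d + 1)) (i : ℕ) (d : ℤ) {m : M}
    (hm : m ∈ imageSum T i) : (DirectSum.decompose ℳ m d : M) ∈ gradedImageSum T ℳ i d := by
  induction i generalizing m with
  | zero =>
    rw [imageSum, Submodule.mem_bot] at hm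
    simp [hm]
  | succ i ih =>
    obtain ⟨a, ha, _, ⟨b, rfl⟩, rfl⟩ := Submodule.mem_sup.1 hm
    rw [DirectSum.decompose_add, DirectSum.add_apply, Submodule.coe_add]
    refine add_mem (Submodule.mem_sup_left (ih ha)) (Submodule.mem_sup_right ?_)
    obtain ⟨e, rfl⟩ : ∃ e, d = e + 1 := ⟨d - 1, by simp⟩
    rw [decompose_map_apply (hT i)]
    refine ⟨_, ?_, rfl⟩
    simp

theorem mem_gradedImageSum [DirectSum.Decomposition ℳ]
    (hT : ∀ i d, ∀ m ∈ ℳ d, T i m ∈ ℳ (d + 1)) {i : ℕ} {d : ℤ} {m : M}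
    (hm : m ∈ imageSum T i) (hd : m ∈ ℳ d) : m ∈ gradedImageSum T ℳ i d := by
  simpa [DirectSum.decompose_of_mem_same ℳ hd] using decompose_mem_gradedImageSum hT i d hm

theorem finrank_gradedImageSum_succ [DirectSum.Decomposition ℳ]
    (hT : ∀ i d, ∀ m ∈ ℳ d, T i m ∈ ℳ (d + 1))
    (hcomm : ∀ i j m, T i (T j m) = T j (T i m)) (i : ℕ)
    (hreg : ∀ m, T i m ∈ imageSum T i → m ∈ imageSum T i)
    (hfin : ∀ d, FiniteDimensional k (ℳ d)) (d : ℤ) :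
    Module.finrank k (gradedImageSum T ℳ (i + 1) (d + 1)) +
        Module.finrank k (gradedImageSum T ℳ i d) =
      Module.finrank k (gradedImageSum T ℳ i (d + 1)) + Module.finrank k (ℳ d) := by
  have hf : ∀ i d, FiniteDimensional k (gradedImageSum T ℳ i d) := fun i d =>
    have := hfin d
    Submodule.finiteDimensional_of_le (gradedImageSum_le hT i d)
  set U := gradedImageSum T ℳ i (d + 1) with hU
  set V := gradedImageSum T ℳ (i + 1) (d + 1) with hV
  have hUV : V = U ⊔ (ℳ d).map (T i) := by
    rw [hV, gradedImageSum, add_sub_cancel_right]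
  have hfd := hfin d
  have := hf i (d + 1)
  have := hf (i + 1) (d + 1)
  have := hf i d
  let g : ℳ d →ₗ[k] M ⧸ U := U.mkQ ∘ₗ T i ∘ₗ (ℳ d).subtype
  have hrange : LinearMap.range g = V.map U.mkQ := by
    rw [hUV, Submodule.map_sup, LinearMap.range_comp, LinearMap.range_comp,
      Submodule.range_subtype, Submodule.mkQ_map_self, bot_sup_eq]
  have hker : LinearMap.ker g = (gradedImageSum T ℳ i d).comap (ℳ d).subtype := by
    ext m
    simp only [g, LinearMap.mem_ker, LinearMap.comp_apply, Submodule.mkQ_apply,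
      Submodule.Quotient.mk_eq_zero, Submodule.mem_comap, Submodule.subtype_apply]
    refine ⟨fun h => mem_gradedImageSum hT (hreg _ (gradedImageSum_le_imageSum i _ h)) m.2,
      fun h => map_gradedImageSum_le hT hcomm i i d ⟨_, h, rfl⟩⟩
  have h1 := LinearMap.finrank_range_add_finrank_ker g
  have h2 := LinearMap.finrank_range_add_finrank_ker (U.mkQ ∘ₗ V.subtype)
  rw [LinearMap.range_comp, Submodule.range_subtype, ← hrange, LinearMap.ker_comp,
    Submodule.ker_mkQ] at h2
  rw [hker] at h1
  have h3 := (Submodule.comapSubtypeEquivOfLe (gradedImageSum_le hT i d)).finrank_eq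
  have h4 := (Submodule.comapSubtypeEquivOfLe (hUV ▸ le_sup_left : U ≤ V)).finrank_eq
  omega

theorem gradedImageSum_eq_of_finrank [DirectSum.Decomposition ℳ]
    (hT : ∀ i d, ∀ m ∈ ℳ d, T i m ∈ ℳ (d + 1))
    (hcomm : ∀ i j m, T i (T j m) = T j (T i m)) (s : ℕ)
    (hreg : ∀ i < s + 1, ∀ m, T i m ∈ imageSum T i → m ∈ imageSum T i)
    (hfin : ∀ d, FiniteDimensional k (ℳ d)) (n : ℕ)
    (hdim : ∀ d : ℕ, Module.finrank k (ℳ (d : ℤ)) = n * Nat.choose (d + s) s)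
    (hneg : ∀ d : ℤ, d < 0 → ℳ d = ⊥) (d : ℕ) :
    gradedImageSum T ℳ (s + 1) (d + 1) = ℳ (d + 1) := by
  have hbot : ∀ i, gradedImageSum T ℳ i 0 = ⊥ := fun i => by
    induction i with
    | zero => rfl
    | succ i ih => rw [gradedImageSum, ih, hneg _ (by norm_num)]; simp
  have key : ∀ e i, i + e = s → ∀ d : ℕ, Module.finrank k (gradedImageSum T ℳ i (d : ℤ)) +
      n * Nat.choose (d + e) e = n * Nat.choose (d + s) s := by
    intro e i
    induction i generalizing e with
    | zero =>
      rintro h d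
      obtain rfl : e = s := by omega
      rw [gradedImageSum, finrank_bot, zero_add]
    | succ i ih =>
      intro h d
      cases d with
      | zero => rw [Nat.cast_zero, hbot, finrank_bot]; simp
      | succ d =>
        have h1 := finrank_gradedImageSum_succ hT hcomm i (hreg i (by omega)) hfin d
        have h2 := ih (e + 1) (by omega) d
        have h3 := ih (e + 1) (by omega) (d + 1)
        have h4 : Nat.choose (d + 1 + (e + 1)) (e + 1) =
          Nat.choose (d + 1 + e) e + Nat.choose (d + (e + 1)) (e + 1) := by
          rw [← add_assoc, Nat.choose_succ_succ, show d + (e + 1) = d + 1 + e by ring]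
        rw [h4, mul_add] at h3
        rw [hdim] at h1
        push_cast at h3 ⊢
        omega
  have := hfin (d + 1)
  refine Submodule.eq_of_le_of_finrank_eq (gradedImageSum_le hT _ _) ?_
  have h1 := finrank_gradedImageSum_succ hT hcomm s (hreg s (by omega)) hfin d
  have h2 := key 0 s rfl d
  have h3 := key 0 s rfl (d + 1)
  have h4 := hdim (d + 1)
  rw [hdim] at h1
  push_cast at h3 h4
  simp only [Nat.choose_zero_right] at h2 h3
  omega

theorem gradedImageSum_le_of_forall {N : Submodule k M} {i : ℕ} {d : ℤ}
    (h : ∀ j < i, ∀ m ∈ ℳ d, T j m ∈ N) : gradedImageSum T ℳ i (d + 1) ≤ N := by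
  induction i with
  | zero => exact bot_le
  | succ i ih =>
    refine sup_le (ih fun j hj => h j (by omega)) ?_
    rintro _ ⟨m, hm, rfl⟩
    rw [add_sub_cancel_right] at hm
    exact h i (by omega) m hm

end GradedRegularSequence

section LinearForms

open MvPolynomial

theorem finrank_homogeneousSubmodule_fin (k : Type*) [Field k] (s d : ℕ) :
    Module.finrank k (homogeneousSubmodule (Fin (s + 1)) k d) = (d + s).choose s := by
  rw [homogeneousSubmodule_eq_finsupp_supported,
    (AddMonoidAlgebra.supportedEquivFinsupp (R := k) (S := k)
      {e : Fin (s + 1) →₀ ℕ | e.degree = d}).finrank_eq]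
  have h : {e : Fin (s + 1) →₀ ℕ | e.degree = d} =
      ((Finset.univ : Finset (Fin (s + 1))).finsuppAntidiag d : Set _) := by
    ext e
    simp [Finsupp.degree_eq_sum]
  rw [h, Module.finrank_finsupp_self]
  simp only [Finset.coe_sort_coe, Fintype.card_coe, Finset.card_finsuppAntidiag_nat_eq_choose,
    Finset.card_univ, Fintype.card_fin]
  rw [show s + 1 + d - 1 = d + s by omega, Nat.choose_symm_add]

variable {k : Type*} [Field k] {σ τ ι : Type*} [Fintype ι] {M : Type*} [AddCommGroup M]
  [Module k M] [Module (MvPolynomial σ k) M]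

theorem linearCombination_mem_of_isHomogeneous {ℳ : ℤ → Submodule k M}
    (hgraded : ∀ (e : ℕ) (d : ℤ) (x : MvPolynomial σ k), x.IsHomogeneous e →
      ∀ m ∈ ℳ d, x • m ∈ ℳ (d + e))
    {b : ι → M} (hb : ∀ j, b j ∈ ℳ 0) {d : ℕ} {v : ι → MvPolynomial σ k}
    (hv : ∀ j, (v j).IsHomogeneous d) : ∑ j, v j • b j ∈ ℳ d :=
  sum_mem fun j _ => by simpa using hgraded d 0 (v j) (hv j) (b j) (hb j)

variable [IsScalarTower k (MvPolynomial σ k) M]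

/-- The combinations of the vectors `b j` whose coefficients are polynomials in the `ℓ i`. -/
noncomputable def polynomialCombination (ℓ : τ → MvPolynomial σ k) (b : ι → M) :
    (ι → MvPolynomial τ k) →ₗ[k] M :=
  (Fintype.linearCombination (MvPolynomial σ k) b).restrictScalars k ∘ₗ
    (aeval ℓ).toLinearMap.compLeft ι

theorem polynomialCombination_apply (ℓ : τ → MvPolynomial σ k) (b : ι → M)
    (v : ι → MvPolynomial τ k) :
    polynomialCombination ℓ b v = ∑ j, aeval ℓ (v j) • b j := rfl

theorem polynomialCombination_smul (ℓ : τ → MvPolynomial σ k) (b : ι → M)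
    (p : MvPolynomial τ k) (v : ι → MvPolynomial τ k) :
    polynomialCombination ℓ b (p • v) = aeval ℓ p • polynomialCombination ℓ b v := by
  simp [polynomialCombination_apply, Finset.smul_sum, mul_smul]

theorem polynomialCombination_mem {ℳ : ℤ → Submodule k M}
    (hgraded : ∀ (e : ℕ) (d : ℤ) (x : MvPolynomial σ k), x.IsHomogeneous e →
      ∀ m ∈ ℳ d, x • m ∈ ℳ (d + e))
    {b : ι → M} (hb : ∀ j, b j ∈ ℳ 0) {ℓ : τ → MvPolynomial σ k}
    (hℓ : ∀ i, (ℓ i).IsHomogeneous 1) {d : ℕ} {v : ι → MvPolynomial τ k}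
    (hv : ∀ j, (v j).IsHomogeneous d) : polynomialCombination ℓ b v ∈ ℳ d :=
  linearCombination_mem_of_isHomogeneous hgraded hb fun j => by
    simpa using (hv j).aeval ℓ hℓ

theorem exists_polynomialCombination_eq {ℳ : ℤ → Submodule k M} {ℓ : τ → MvPolynomial σ k}
    (hgen : ∀ (d : ℕ) (N : Submodule k M), (∀ i, ∀ m ∈ ℳ d, ℓ i • m ∈ N) → ℳ (d + 1) ≤ N)
    {b : ι → M} (hb : ℳ 0 ≤ Submodule.span k (Set.range b)) (d : ℕ) {m : M} (hm : m ∈ ℳ d) :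
    ∃ v : ι → MvPolynomial τ k,
      (∀ j, (v j).IsHomogeneous d) ∧ polynomialCombination ℓ b v = m := by
  suffices h : ℳ d ≤ (Submodule.pi Set.univ fun _ : ι => homogeneousSubmodule τ k d).map
      (polynomialCombination ℓ b) by
    obtain ⟨v, hv, hvm⟩ := h hm
    exact ⟨v, fun j => hv j trivial, hvm⟩
  clear hm m
  induction d with
  | zero =>
    intro m hm
    obtain ⟨c, rfl⟩ := (Submodule.mem_span_range_iff_exists_fun k).1 (hb (by simpa using hm))
    refine ⟨fun j => C (c j), fun j _ => isHomogeneous_C _ _, ?_⟩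
    rw [polynomialCombination_apply]
    refine Finset.sum_congr rfl fun j _ => ?_
    rw [algHom_C, algebraMap_smul]
  | succ d ih =>
    push_cast
    refine hgen d _ fun i m hm => ?_
    obtain ⟨v, hv, rfl⟩ := ih hm
    refine ⟨(X i : MvPolynomial τ k) • v, fun j _ => ?_, ?_⟩
    · have := (isHomogeneous_X k i).mul (hv j trivial)
      rwa [add_comm] at this
    · simp [polynomialCombination_smul]

theorem polynomialCombination_injective {s : ℕ} {ℳ : ℤ → Submodule k M}
    (hdecomp : DirectSum.IsInternal ℳ)
    (hgraded : ∀ (e : ℕ) (d : ℤ) (x : MvPolynomial σ k), x.IsHomogeneous e →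
      ∀ m ∈ ℳ d, x • m ∈ ℳ (d + e))
    {ℓ : Fin (s + 1) → MvPolynomial σ k} (hℓ : ∀ i, (ℓ i).IsHomogeneous 1)
    (hgen : ∀ (d : ℕ) (N : Submodule k M), (∀ i, ∀ m ∈ ℳ d, ℓ i • m ∈ N) → ℳ (d + 1) ≤ N)
    (hfin : ∀ d, FiniteDimensional k (ℳ d))
    (hdim : ∀ d : ℕ, Module.finrank k (ℳ (d : ℤ)) = Fintype.card ι * (d + s).choose s)
    {b : ι → M} (hb : ∀ j, b j ∈ ℳ 0) (hb' : ℳ 0 ≤ Submodule.span k (Set.range b)) :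
    Function.Injective (polynomialCombination ℓ b) := by
  have hhom : ∀ (d : ℕ) (v : ι → MvPolynomial (Fin (s + 1)) k), (∀ j, (v j).IsHomogeneous d) →
      polynomialCombination ℓ b v = 0 → v = 0 := by
    intro d
    let W := homogeneousSubmodule (Fin (s + 1)) k d
    have : FiniteDimensional k W := Module.Finite.of_fg (homogeneousSubmodule_fg _ _ d)
    have := hfin d
    let g : (ι → W) →ₗ[k] ℳ d :=
      (polynomialCombination ℓ b ∘ₗ W.subtype.compLeft ι).codRestrict (ℳ d) fun v =>
        polynomialCombination_mem hgraded hb hℓ fun j => (v j).2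
    have hg : Function.Surjective g := fun m => by
      obtain ⟨v, hv, hvm⟩ := exists_polynomialCombination_eq hgen hb' d m.2
      exact ⟨fun j => ⟨v j, hv j⟩, Subtype.ext hvm⟩
    have hg' : Function.Injective g :=
      (LinearMap.injective_iff_surjective_of_finrank_eq_finrank (by
        rw [Module.finrank_pi_fintype, hdim]
        simp [W, finrank_homogeneousSubmodule_fin])).2 hg
    intro v hv hv0
    have h0 := hg' (a₁ := fun j => ⟨v j, hv j⟩) (a₂ := 0) (Subtype.ext (hv0.trans (by simp)))
    funext j
    exact congrArg Subtype.val (congrFun h0 j)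
  rw [injective_iff_map_eq_zero]
  intro v hv
  let := hdecomp.chooseDecomposition
  have hcomp : ∀ d : ℕ, (fun j => homogeneousComponent d (v j)) = 0 := by
    intro d
    refine hhom d _ (fun j => homogeneousComponent_isHomogeneous _ _) ?_
    let D := Finset.univ.sup (fun j => (v j).totalDegree)
    have hsum : v = ∑ e ∈ Finset.range (D + d + 1), fun j => homogeneousComponent e (v j) := by
      funext j
      rw [Finset.sum_apply]
      conv_lhs => rw [← sum_homogeneousComponent (v j)]
      have hj : (v j).totalDegree ≤ D := Finset.le_sup (f := fun j => (v j).totalDegree)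
        (Finset.mem_univ j)
      refine Finset.sum_subset (fun e he => ?_) fun e _ he => ?_
      · simp only [Finset.mem_range] at he ⊢
        omega
      · exact homogeneousComponent_eq_zero _ _ (by simpa using he)
    have hmem : ∀ e : ℕ, polynomialCombination ℓ b (fun j => homogeneousComponent e (v j)) ∈
        ℳ e := fun e =>
      polynomialCombination_mem hgraded hb hℓ fun j => homogeneousComponent_isHomogeneous _ _
    let pr : M →ₗ[k] M := (ℳ d).subtype ∘ₗ DirectSum.component k ℤ (fun i => ℳ i) d ∘ₗ
      (DirectSum.decomposeLinearEquiv ℳ).toLinearMap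
    have h := congrArg pr hv
    rw [hsum, map_sum, map_sum, map_zero, Finset.sum_eq_single_of_mem d (by simp)] at h
    · exact (DirectSum.decompose_of_mem_same ℳ (hmem d)).symm.trans h
    · intro e _ hed
      exact DirectSum.decompose_of_mem_ne ℳ (hmem e) (Nat.cast_injective.ne hed)
  funext j
  rw [← sum_homogeneousComponent (v j)]
  exact Finset.sum_eq_zero fun d _ => congrFun (hcomp d) j

theorem linearIndependent_of_polynomialCombination_injective [Fintype τ] [Nonempty ι]
    {ℓ : τ → MvPolynomial σ k} {b : ι → M}
    (hinj : Function.Injective (polynomialCombination ℓ b)) : LinearIndependent k ℓ := by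
  classical
  rw [Fintype.linearIndependent_iff]
  intro c hc
  obtain ⟨j⟩ := ‹Nonempty ι›
  have h : (∑ i, c i • X i : MvPolynomial τ k) • Pi.single (M := fun _ => MvPolynomial τ k) j 1
      = 0 := by
    apply hinj
    rw [polynomialCombination_smul, map_sum]
    simp [hc]
  have h' : (∑ i, c i • X i : MvPolynomial τ k) = 0 := by simpa using congrFun h j
  exact Fintype.linearIndependent_iff.1 (linearIndependent_X τ k) c h'

/-- Fewer linear forms than variables vanish at a common nonzero point. -/
theorem exists_ne_zero_eval_eq_zero [Fintype σ] [Fintype τ]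
    (hcard : Fintype.card τ < Fintype.card σ) {ℓ : τ → MvPolynomial σ k}
    (hℓ : ∀ i, (ℓ i).IsHomogeneous 1) : ∃ p : σ → k, p ≠ 0 ∧ ∀ i, eval p (ℓ i) = 0 := by
  have hc : ∀ i, ∃ c : σ → k, ∑ j, c j • X j = ℓ i := fun i => by
    have h : ℓ i ∈ homogeneousSubmodule σ k 1 := hℓ i
    rw [homogeneousSubmodule_one_eq_span_X] at h
    exact (Submodule.mem_span_range_iff_exists_fun k).1 h
  choose c hc using hc
  obtain ⟨p, hp, hp0⟩ := Submodule.exists_mem_ne_zero_of_ne_bot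
    (LinearMap.ker_ne_bot_of_finrank_lt (f := (Matrix.of c).mulVecLin) (by simpa using hcard))
  refine ⟨p, hp0, fun i => ?_⟩
  have h := congrFun hp i
  rw [← hc i]
  simpa [Matrix.mulVec, dotProduct, smul_eval] using h

theorem exists_X_span_insert_range {s : ℕ} {ℓ : Fin (s + 1) → MvPolynomial (Fin (s + 2)) k}
    (hℓ : ∀ i, (ℓ i).IsHomogeneous 1) (hli : LinearIndependent k ℓ) :
    ∃ (z : Fin (s + 2)) (p : Fin (s + 2) → k), p z ≠ 0 ∧ (∀ i, eval p (ℓ i) = 0) ∧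
      ∀ j, (X j : MvPolynomial (Fin (s + 2)) k) ∈ Submodule.span k (insert (X z) (Set.range ℓ)) := by
  obtain ⟨p, hp0, hp⟩ := exists_ne_zero_eval_eq_zero (by simp) hℓ
  obtain ⟨z, hz⟩ := Function.ne_iff.1 hp0
  refine ⟨z, p, hz, hp, fun j => ?_⟩
  have hXz : (X z : MvPolynomial (Fin (s + 2)) k) ∉ Submodule.span k (Set.range ℓ) := by
    intro h
    have hle : Submodule.span k (Set.range ℓ) ≤ LinearMap.ker (aeval p).toLinearMap := by
      rw [Submodule.span_le]
      rintro _ ⟨i, rfl⟩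
      simpa [aeval_eq_eval] using hp i
    exact hz (by simpa using hle h)
  have hli' := linearIndependent_finCons.2 ⟨hli, hXz⟩
  have hspan : Submodule.span k (Set.range (Fin.cons (X z) ℓ : Fin (s + 2) → _)) =
      homogeneousSubmodule (Fin (s + 2)) k 1 := by
    have : FiniteDimensional k (homogeneousSubmodule (Fin (s + 2)) k 1) :=
      Module.Finite.of_fg (homogeneousSubmodule_fg _ _ 1)
    refine Submodule.eq_of_le_of_finrank_eq ?_ ?_
    · rw [Submodule.span_le]
      rintro _ ⟨i, rfl⟩
      refine Fin.cases ?_ (fun i => ?_) i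
      · exact isHomogeneous_X _ _
      · exact hℓ i
    · rw [finrank_span_eq_card hli', finrank_homogeneousSubmodule_fin, Nat.add_comm 1,
        Nat.choose_succ_self_right, Fintype.card_fin]
  rw [← Fin.range_cons, hspan]
  exact isHomogeneous_X _ _

theorem linearCombination_surjective_of_gradedPieces {ℳ : ℤ → Submodule k M}
    (hdecomp : DirectSum.IsInternal ℳ) (hneg : ∀ d : ℤ, d < 0 → ℳ d = ⊥)
    {ℓ : τ → MvPolynomial σ k}
    (hgen : ∀ (d : ℕ) (N : Submodule k M), (∀ i, ∀ m ∈ ℳ d, ℓ i • m ∈ N) → ℳ (d + 1) ≤ N)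
    {b : ι → M} (hb : ℳ 0 ≤ Submodule.span k (Set.range b)) :
    Function.Surjective (Fintype.linearCombination (MvPolynomial σ k) b) := by
  have h : ⊤ ≤ (LinearMap.range (Fintype.linearCombination (MvPolynomial σ k) b)).restrictScalars
      k := by
    rw [← hdecomp.submodule_iSup_eq_top]
    refine iSup_le fun d m hm => ?_
    obtain hd | hd := lt_or_ge d 0
    · rw [hneg d hd, Submodule.mem_bot] at hm
      rw [hm]
      exact zero_mem _
    · lift d to ℕ using hd
      obtain ⟨v, -, rfl⟩ := exists_polynomialCombination_eq hgen hb d hm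
      exact ⟨fun j => aeval ℓ (v j), rfl⟩
  exact fun m => h (Submodule.mem_top (x := m))

variable [DecidableEq ι]

/-- The matrix `x - B(ℓ)`, where `B` has entries in a polynomial ring evaluated at `ℓ`. -/
noncomputable def subAevalMatrix (x : MvPolynomial σ k) (ℓ : τ → MvPolynomial σ k)
    (B : Matrix ι ι (MvPolynomial τ k)) : Matrix ι ι (MvPolynomial σ k) :=
  Matrix.scalar ι x - B.map (aeval ℓ)

theorem subAevalMatrix_isHomogeneous {x : MvPolynomial σ k} (hx : x.IsHomogeneous 1)
    {ℓ : τ → MvPolynomial σ k} (hℓ : ∀ i, (ℓ i).IsHomogeneous 1)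
    {B : Matrix ι ι (MvPolynomial τ k)} (hB : ∀ i j, (B i j).IsHomogeneous 1) (i j : ι) :
    (subAevalMatrix x ℓ B i j).IsHomogeneous 1 := by
  refine IsHomogeneous.sub ?_ (by simpa using (hB i j).aeval ℓ hℓ)
  rw [Matrix.scalar_apply, Matrix.diagonal_apply]
  split_ifs
  exacts [hx, isHomogeneous_zero _ _ _]

theorem subAevalMatrix_mulVec_injective {x : MvPolynomial σ k} {ℓ : τ → MvPolynomial σ k}
    {B : Matrix ι ι (MvPolynomial τ k)} (hB : ∀ i j, (B i j).IsHomogeneous 1)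
    {p : σ → k} (hx : eval p x ≠ 0) (hℓ : ∀ i, eval p (ℓ i) = 0) :
    Function.Injective (subAevalMatrix x ℓ B).mulVec := by
  refine Matrix.mulVec_injective_of_det_mem_nonZeroDivisors (mem_nonZeroDivisors_of_ne_zero ?_)
  intro h
  have hBp : ∀ i j, eval p (aeval ℓ (B i j)) = 0 := fun i j => by
    have h1 : (aeval p).comp (aeval ℓ : MvPolynomial τ k →ₐ[k] _) = aeval (0 : τ → k) := by
      ext i
      simpa [aeval_eq_eval] using hℓ i
    have h2 := DFunLike.congr_fun h1 (B i j)
    rw [AlgHom.comp_apply, aeval_zero, constantCoeff_eq, (hB i j).coeff_eq_zero (by simp),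
      map_zero] at h2
    exact h2
  have h' := congrArg (eval p) h
  rw [RingHom.map_det, map_zero] at h'
  have hdiag : (eval p).mapMatrix (subAevalMatrix x ℓ B) = Matrix.scalar ι (eval p x) := by
    ext i j
    rw [RingHom.mapMatrix_apply, Matrix.map_apply, subAevalMatrix, Matrix.sub_apply, map_sub,
      Matrix.map_apply, hBp, sub_zero]
    simp [Matrix.diagonal_apply, apply_ite (eval p)]
  rw [hdiag, Matrix.scalar_apply, Matrix.det_diagonal, Finset.prod_const] at h'
  exact pow_ne_zero _ hx h'

theorem linearCombination_subAevalMatrix_mulVec {x : MvPolynomial σ k} {ℓ : τ → MvPolynomial σ k}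
    {b : ι → M} {B : Matrix ι ι (MvPolynomial τ k)}
    (hB : ∀ j, x • b j = polynomialCombination ℓ b (B.col j)) (v : ι → MvPolynomial σ k) :
    Fintype.linearCombination (MvPolynomial σ k) b ((subAevalMatrix x ℓ B).mulVec v) = 0 := by
  have h : ∀ j, ∑ i, subAevalMatrix x ℓ B i j • b i = 0 := fun j => by
    simp [subAevalMatrix, sub_smul, Matrix.diagonal_apply, hB, polynomialCombination_apply]
  simp only [Fintype.linearCombination_apply, Matrix.mulVec, dotProduct, Finset.sum_smul]
  rw [Finset.sum_comm]
  refine Finset.sum_eq_zero fun j _ => ?_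
  simp_rw [mul_comm _ (v j), mul_smul]
  rw [← Finset.smul_sum, h, smul_zero]

theorem exists_eq_subAevalMatrix_mulVec_add {x : MvPolynomial σ k} {ℓ : τ → MvPolynomial σ k}
    (hspan : ∀ j, (X j : MvPolynomial σ k) ∈ Submodule.span k (insert x (Set.range ℓ)))
    (B : Matrix ι ι (MvPolynomial τ k)) (v : ι → MvPolynomial σ k) :
    ∃ (w : ι → MvPolynomial σ k) (u : ι → MvPolynomial τ k),
      v = (subAevalMatrix x ℓ B).mulVec w + fun j => aeval ℓ (u j) := by
  let W : Submodule k (ι → MvPolynomial σ k) :=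
    LinearMap.range ((subAevalMatrix x ℓ B).mulVecLin.restrictScalars k) ⊔
      LinearMap.range ((aeval ℓ : MvPolynomial τ k →ₐ[k] _).toLinearMap.compLeft ι)
  have hmem : ∀ (w : ι → MvPolynomial σ k) (u : ι → MvPolynomial τ k),
      (subAevalMatrix x ℓ B).mulVec w + (fun j => aeval ℓ (u j)) ∈ W :=
    fun w u => Submodule.add_mem_sup ⟨w, rfl⟩ ⟨u, rfl⟩
  have hW : ∀ y ∈ W, ∃ (w : ι → MvPolynomial σ k) (u : ι → MvPolynomial τ k),
      y = (subAevalMatrix x ℓ B).mulVec w + fun j => aeval ℓ (u j) := by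
    intro y hy
    obtain ⟨_, ⟨w, rfl⟩, _, ⟨u, rfl⟩, rfl⟩ := Submodule.mem_sup.1 hy
    exact ⟨w, u, rfl⟩
  have hx : ∀ y ∈ W, x • y ∈ W := by
    intro y hy
    obtain ⟨w, u, rfl⟩ := hW y hy
    convert hmem (x • w + fun j => aeval ℓ (u j)) (B.mulVec u) using 1
    rw [Matrix.mulVec_add, Matrix.mulVec_smul, smul_add, add_assoc]
    congr 1
    rw [subAevalMatrix, Matrix.sub_mulVec]
    funext j
    simp [Matrix.mulVec, dotProduct]
  have hℓ : ∀ i, ∀ y ∈ W, ℓ i • y ∈ W := by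
    intro i y hy
    obtain ⟨w, u, rfl⟩ := hW y hy
    convert hmem (ℓ i • w) ((X i : MvPolynomial τ k) • u) using 1
    rw [Matrix.mulVec_smul, smul_add]
    congr 1
    funext j
    simp
  have hX : ∀ j, ∀ y ∈ W, (X j : MvPolynomial σ k) • y ∈ W := by
    intro j y hy
    have hle : Submodule.span k (insert x (Set.range ℓ)) ≤
        W.comap ((LinearMap.toSpanSingleton (MvPolynomial σ k) _ y).restrictScalars k) := by
      rw [Submodule.span_le]
      rintro _ (rfl | ⟨i, rfl⟩)
      exacts [hx y hy, hℓ i y hy]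
    exact hle (hspan j)
  have hsmul : ∀ q : MvPolynomial σ k, ∀ y ∈ W, q • y ∈ W := by
    intro q
    induction q using MvPolynomial.induction_on with
    | C a =>
      intro y hy
      rw [← algebraMap_eq, algebraMap_smul]
      exact W.smul_mem a hy
    | add p q hp hq =>
      intro y hy
      rw [add_smul]
      exact add_mem (hp y hy) (hq y hy)
    | mul_X p j hp =>
      intro y hy
      rw [mul_smul]
      exact hp _ (hX j y hy)
  apply hW
  rw [pi_eq_sum_univ' v]
  refine sum_mem fun j _ => hsmul _ _ ?_
  convert hmem 0 (Pi.single j 1) using 1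
  funext i
  simp [Pi.single_apply, eq_comm]

theorem ker_linearCombination_eq_range_subAevalMatrix {x : MvPolynomial σ k}
    {ℓ : τ → MvPolynomial σ k}
    (hspan : ∀ j, (X j : MvPolynomial σ k) ∈ Submodule.span k (insert x (Set.range ℓ)))
    {b : ι → M} (hinj : Function.Injective (polynomialCombination ℓ b))
    {B : Matrix ι ι (MvPolynomial τ k)}
    (hB : ∀ j, x • b j = polynomialCombination ℓ b (B.col j)) :
    LinearMap.ker (Fintype.linearCombination (MvPolynomial σ k) b) =
      LinearMap.range (subAevalMatrix x ℓ B).mulVecLin := by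
  refine le_antisymm (fun v hv => ?_) ?_
  · obtain ⟨w, u, rfl⟩ := exists_eq_subAevalMatrix_mulVec_add hspan B v
    rw [LinearMap.mem_ker, map_add, linearCombination_subAevalMatrix_mulVec hB, zero_add] at hv
    obtain rfl : u = 0 := hinj (hv.trans (map_zero _).symm)
    exact ⟨w, (add_eq_left.2 (_root_.funext fun j => map_zero _)).symm⟩
  · rintro _ ⟨v, rfl⟩
    exact linearCombination_subAevalMatrix_mulVec hB v

end LinearForms
section RegularSequence

variable {k R M : Type*} [Field k] [CommRing R] [Algebra k R] [AddCommGroup M] [Module k M]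
  [Module R M] [IsScalarTower k R M]

theorem imageSum_lsmul_eq_ofList_take_smul_top (rs : List R) {i : ℕ} (hi : i ≤ rs.length) :
    imageSum (fun j => Algebra.lsmul k k M (rs.getD j 0)) i =
      (Ideal.ofList (rs.take i) • (⊤ : Submodule R M)).restrictScalars k := by
  induction i with
  | zero => simp [imageSum]
  | succ i ih =>
    have hi' : i < rs.length := hi
    rw [imageSum, ih hi'.le, List.take_succ_eq_append_getElem hi', Ideal.ofList_append,
      Ideal.ofList_singleton, Submodule.sup_smul, Submodule.ideal_span_singleton_smul,
      Submodule.restrictScalars_sup]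
    congr 1
    ext m
    simp [Submodule.mem_smul_pointwise_iff_exists, hi']

theorem mem_imageSum_of_isWeaklyRegular {rs : List R}
    (hreg : RingTheory.Sequence.IsWeaklyRegular M rs) {i : ℕ} (hi : i < rs.length) {m : M}
    (hm : rs.getD i 0 • m ∈ imageSum (fun j => Algebra.lsmul k k M (rs.getD j 0)) i) :
    m ∈ imageSum (fun j => Algebra.lsmul k k M (rs.getD j 0)) i := by
  rw [imageSum_lsmul_eq_ofList_take_smul_top rs hi.le, Submodule.restrictScalars_mem] at hm ⊢
  rw [List.getD_eq_getElem _ _ hi] at hm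
  rw [← Submodule.Quotient.mk_eq_zero] at hm ⊢
  rw [Submodule.Quotient.mk_smul] at hm
  exact (hreg.regular_mod_prev i hi).right_eq_zero_of_smul hm

end RegularSequence

section LinearPresentation

open MvPolynomial

/-- A graded module with the Hilbert function of a free module over a polynomial ring in `s + 1`
variables, on which `s + 1` linear forms in `s + 2` variables form a weakly regular sequence, has
a linear presentation of length one. -/
theorem exists_linear_presentation {k : Type*} [Field k] {s n : ℕ} (hn : 0 < n) {M : Type*}
    [AddCommGroup M] [Module k M] [Module (MvPolynomial (Fin (s + 2)) k) M]
    [IsScalarTower k (MvPolynomial (Fin (s + 2)) k) M] {ℳ : ℤ → Submodule k M}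
    (hdecomp : DirectSum.IsInternal ℳ)
    (hgraded : ∀ (e : ℕ) (d : ℤ) (x : MvPolynomial (Fin (s + 2)) k), x.IsHomogeneous e →
      ∀ m ∈ ℳ d, x • m ∈ ℳ (d + e))
    (hdim : ∀ d : ℕ, Module.finrank k (ℳ (d : ℤ)) = n * (d + s).choose s)
    (hneg : ∀ d : ℤ, d < 0 → ℳ d = ⊥)
    {ℓ : Fin (s + 1) → MvPolynomial (Fin (s + 2)) k} (hℓ : ∀ i, (ℓ i).IsHomogeneous 1)
    (hreg : RingTheory.Sequence.IsWeaklyRegular M (List.ofFn ℓ)) :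
    ∃ (A : Matrix (Fin n) (Fin n) (MvPolynomial (Fin (s + 2)) k))
      (π : (Fin n → MvPolynomial (Fin (s + 2)) k) →ₗ[MvPolynomial (Fin (s + 2)) k] M),
      (∀ i j, (A i j).IsHomogeneous 1) ∧
      Function.Surjective π ∧
      LinearMap.ker π = LinearMap.range A.mulVecLin ∧
      Function.Injective A.mulVecLin ∧
      ∀ (d : ℕ) (v : Fin n → MvPolynomial (Fin (s + 2)) k),
        (∀ j, (v j).IsHomogeneous d) → π v ∈ ℳ (d : ℤ) := by
  have hfin : ∀ d, FiniteDimensional k (ℳ d) := fun d => by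
    obtain hd | hd := lt_or_ge d 0
    · rw [hneg d hd]
      infer_instance
    · lift d to ℕ using hd
      refine Module.finite_of_finrank_pos ?_
      rw [hdim]
      exact Nat.mul_pos hn (Nat.choose_pos (by omega))
  have hgen : ∀ (d : ℕ) (N : Submodule k M), (∀ i, ∀ m ∈ ℳ d, ℓ i • m ∈ N) → ℳ (d + 1) ≤ N := by
    intro d N hN
    let := hdecomp.chooseDecomposition
    let T : ℕ → M →ₗ[k] M := fun j => Algebra.lsmul k k M ((List.ofFn ℓ).getD j 0)
    have hlin : ∀ i, ((List.ofFn ℓ).getD i 0).IsHomogeneous 1 := fun i => by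
      by_cases hi : i < s + 1
      · rw [List.getD_eq_getElem _ _ (by simpa using hi), List.getElem_ofFn]
        exact hℓ _
      · rw [List.getD_eq_default _ _ (by simpa using hi)]
        exact isHomogeneous_zero _ _ _
    have hT : ∀ i d, ∀ m ∈ ℳ d, T i m ∈ ℳ (d + 1) := fun i d m hm =>
      hgraded 1 d _ (hlin i) m hm
    rw [← gradedImageSum_eq_of_finrank hT (fun i j m => smul_comm _ _ m) s
      (fun i hi m hm => mem_imageSum_of_isWeaklyRegular hreg (by simpa using hi) hm)
      hfin n hdim hneg d]
    refine gradedImageSum_le_of_forall fun j hj m hm => ?_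
    have hTj : T j m = ℓ ⟨j, hj⟩ • m := by
      simp only [T]
      rw [List.getD_eq_getElem _ _ (by simpa using hj), List.getElem_ofFn, Algebra.lsmul_coe]
    rw [hTj]
    exact hN _ m hm
  have h0 : Module.finrank k (ℳ 0) = n := by simpa using hdim 0
  let β : Module.Basis (Fin n) k (ℳ 0) := Module.finBasisOfFinrankEq k (ℳ 0) h0
  let b : Fin n → M := fun j => β j
  have hb : ∀ j, b j ∈ ℳ 0 := fun j => (β j).2
  have hb' : ℳ 0 ≤ Submodule.span k (Set.range b) := by
    have h := congrArg (Submodule.map (ℳ 0).subtype) β.span_eq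
    rw [Submodule.map_span, ← Set.range_comp, Submodule.map_subtype_top] at h
    exact h.ge
  have : Nonempty (Fin n) := ⟨⟨0, hn⟩⟩
  have hinj := polynomialCombination_injective hdecomp hgraded hℓ hgen hfin
    (by simpa using hdim) hb hb'
  obtain ⟨z, p, hz, hp, hspan⟩ := exists_X_span_insert_range hℓ
    (linearIndependent_of_polynomialCombination_injective hinj)
  have hX : ∀ j, ∃ v : Fin n → MvPolynomial (Fin (s + 1)) k, (∀ i, (v i).IsHomogeneous 1) ∧
      polynomialCombination ℓ b v = (X z : MvPolynomial (Fin (s + 2)) k) • b j := fun j =>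
    exists_polynomialCombination_eq hgen hb' 1
      (by simpa using hgraded 1 0 _ (isHomogeneous_X k z) _ (hb j))
  choose B hB hBX using hX
  let B' : Matrix (Fin n) (Fin n) (MvPolynomial (Fin (s + 1)) k) := Matrix.of fun i j => B j i
  have hB' : ∀ i j, (B' i j).IsHomogeneous 1 := fun i j => hB j i
  exact ⟨subAevalMatrix (X z) ℓ B', Fintype.linearCombination _ b,
    subAevalMatrix_isHomogeneous (isHomogeneous_X _ _) hℓ hB',
    linearCombination_surjective_of_gradedPieces hdecomp hneg hgen hb',
    ker_linearCombination_eq_range_subAevalMatrix hspan hinj fun j => (hBX j).symm,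
    subAevalMatrix_mulVec_injective hB' (by simpa using hz) hp,
    fun d v hv => linearCombination_mem_of_isHomogeneous hgraded hb hv⟩

end LinearPresentation

/-- Let `k` be an infinite field, `R = k[x₀,…,x₅]`, `f` an
irreducible homogeneous cubic, `S = R/(f)`, `r ≥ 1`. Let `M` be a finitely
generated graded `S`-module with Hilbert function `dim_k M_d = 3r·C(d+4,4)` for
`d ≥ 0`, `M_d = 0` for `d < 0`, admitting five linear forms whose images in `S`
form an `M`-regular sequence. Then `M` has a graded `R`-free presentation
`0 → R(−1)^{3r} → R^{3r} → M → 0` by a matrix of linear forms. -/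
theorem ulrich_module_linear_resolution
    {k : Type*} [Field k] [Infinite k]
    (f : MvPolynomial (Fin 6) k) (hf_irr : Irreducible f)
    (hf_hom : f.IsHomogeneous 3) (r : ℕ) (hr : 1 ≤ r)
    (M : Type*) [AddCommGroup M]
    [Module k M]
    [Module (MvPolynomial (Fin 6) k) M]
    [Module (MvPolynomial (Fin 6) k ⧸ Ideal.span {f}) M]
    [IsScalarTower (MvPolynomial (Fin 6) k)
      (MvPolynomial (Fin 6) k ⧸ Ideal.span {f}) M]
    [IsScalarTower k (MvPolynomial (Fin 6) k ⧸ Ideal.span {f}) M]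
    (hfg : Module.Finite (MvPolynomial (Fin 6) k ⧸ Ideal.span {f}) M)
    (ℳ : ℤ → Submodule k M)
    (hdecomp : DirectSum.IsInternal ℳ)
    (hgraded : ∀ (e : ℕ) (d : ℤ) (x : MvPolynomial (Fin 6) k),
      x.IsHomogeneous e → ∀ m ∈ ℳ d,
        (Ideal.Quotient.mk (Ideal.span {f}) x) • m ∈ ℳ (d + e))
    (hdim : ∀ d : ℕ, Module.finrank k (ℳ (d : ℤ)) = 3 * r * Nat.choose (d + 4) 4)
    (hneg : ∀ d : ℤ, d < 0 → ℳ d = ⊥)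
    (hreg : ∃ ℓ : Fin 5 → MvPolynomial (Fin 6) k,
      (∀ i, (ℓ i).IsHomogeneous 1) ∧
      RingTheory.Sequence.IsRegular M
        (List.ofFn fun i => Ideal.Quotient.mk (Ideal.span {f}) (ℓ i))) :
    ∃ (A : Matrix (Fin (3 * r)) (Fin (3 * r)) (MvPolynomial (Fin 6) k))
      (π : (Fin (3 * r) → MvPolynomial (Fin 6) k) →ₗ[MvPolynomial (Fin 6) k] M),
      (∀ i j, (A i j).IsHomogeneous 1) ∧
      Function.Surjective π ∧
      LinearMap.ker π = LinearMap.range A.mulVecLin ∧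
      Function.Injective A.mulVecLin ∧
      ∀ (d : ℕ) (v : Fin (3 * r) → MvPolynomial (Fin 6) k),
        (∀ j, (v j).IsHomogeneous d) → π v ∈ ℳ (d : ℤ) := by
  have hmk : ∀ (x : MvPolynomial (Fin 6) k) (m : M),
      Ideal.Quotient.mk (Ideal.span {f}) x • m = x • m := fun x m =>
    algebraMap_smul (MvPolynomial (Fin 6) k ⧸ Ideal.span {f}) x m
  have : IsScalarTower k (MvPolynomial (Fin 6) k) M := ⟨fun c x m => by
    rw [← hmk, ← hmk x m, ← smul_assoc]
    rfl⟩
  obtain ⟨ℓ, hℓ, hreg⟩ := hreg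
  have hreg' : RingTheory.Sequence.IsWeaklyRegular M (List.ofFn ℓ) := by
    rw [← RingTheory.Sequence.isWeaklyRegular_map_algebraMap_iff
      (MvPolynomial (Fin 6) k ⧸ Ideal.span {f}), List.map_ofFn]
    exact hreg.toIsWeaklyRegular
  exact exists_linear_presentation (s := 4) (by omega) hdecomp
    (fun e d x hx m hm => hmk x m ▸ hgraded e d x hx m hm) hdim hneg hℓ hreg'
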